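/- arXiv:1301.7320 — 8 statements merged into one kernel-verified Lean document; each statement's English description precedes it below -/
import Mathlib

section
/- Let n, m be positive integers and let p_1, …, p_m ∈ [0,1) satisfy n·∑_{i=1}^m p_i² > 1. Define F : [0,1] → ℝ by F(x) = ∏_{i=1}^m [1 − p_i·(1 − (1 − p_i·(1−x))^n)]. Then there exists a unique ρ ∈ [0,1) with F(ρ) = ρ. -/
open Filter Topology in
/-- A function with derivative greater than `1` at a fixed point `a` lies strictly below the
diagonal immediately to the left of `a`. -/
lemma eventually_lt_id_nhdsLT {f : ℝ → ℝ} {a d : ℝ} (hf : HasDerivAt f d a) (ha : f a = a)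
    (hd : 1 < d) : ∀ᶠ x in 𝓝[<] a, f x < x := by
  have hslope : ∀ᶠ x in 𝓝[<] a, 1 < slope f a x :=
    ((hasDerivAt_iff_tendsto_slope.1 hf).mono_left
      (nhdsWithin_mono _ fun x hx => ne_of_lt hx)).eventually_const_lt hd
  filter_upwards [hslope, self_mem_nhdsWithin] with x hx hxa
  rw [slope_def_field, ha, lt_div_iff_of_neg (sub_neg.2 hxa)] at hx
  linarith

open Set Filter Topology in
/-- A convex continuous function on `[0, 1]` that is positive at `0` and fixes `1` with derivative
greater than `1` has exactly one fixed point in `[0, 1)`. -/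
lemma ConvexOn.existsUnique_fixed_point_Ico {f : ℝ → ℝ} {d : ℝ} (hconv : ConvexOn ℝ (Icc 0 1) f)
    (hcont : Continuous f) (h0 : 0 < f 0) (h1 : f 1 = 1) (hf : HasDerivAt f d 1) (hd : 1 < d) :
    ∃! x : ℝ, x ∈ Ico (0 : ℝ) 1 ∧ f x = x := by
  have hlt := eventually_lt_id_nhdsLT hf h1 hd
  have below : ∀ b < (1 : ℝ), ∃ x, b < x ∧ x < 1 ∧ f x < x := fun b hb => by
    obtain ⟨x, hx, hxb⟩ := (hlt.and (Ioo_mem_nhdsLT hb)).exists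
    exact ⟨x, hxb.1, hxb.2, hx⟩
  have no_lt : ∀ x ∈ Ico (0 : ℝ) 1, f x = x → ∀ y ∈ Ico (0 : ℝ) 1, f y = y → ¬ x < y := by
    intro x hx hfx y hy hfy hxy
    obtain ⟨z, hyz, hz1, hfz⟩ := below y hy.2
    have := hconv.slope_mono_adjacent ⟨hx.1, hx.2.le⟩ ⟨(hx.1.trans_lt (hxy.trans hyz)).le, hz1.le⟩
      hxy hyz
    rw [hfx, hfy, div_self (sub_pos.2 hxy).ne', le_div_iff₀ (sub_pos.2 hyz)] at this
    linarith
  obtain ⟨b, hb0, hb1, hfb⟩ := below 0 one_pos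
  obtain ⟨x, hx, hfx⟩ := intermediate_value_Icc' hb0.le
    (f := fun x => f x - x) (by fun_prop) (show (0 : ℝ) ∈ Icc (f b - b) (f 0 - 0) from
      ⟨by linarith, by linarith⟩)
  have hx' : x ∈ Ico (0 : ℝ) 1 := ⟨hx.1, hx.2.trans_lt hb1⟩
  have hfx' : f x = x := sub_eq_zero.1 hfx
  refine ⟨x, ⟨hx', hfx'⟩, fun y ⟨hy, hfy⟩ => ?_⟩
  exact le_antisymm (le_of_not_gt (no_lt x hx' hfx' y hy hfy))
    (le_of_not_gt (no_lt y hy hfy x hx' hfx'))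

/-- A finite product of nonnegative, monotone, convex functions is nonnegative, monotone
and convex. -/
lemma convexOn_prod_of_monotoneOn {ι : Type*} {s : Set ℝ} (hs : Convex ℝ s) (t : Finset ι)
    {f : ι → ℝ → ℝ} (h0 : ∀ i ∈ t, ∀ x ∈ s, 0 ≤ f i x) (hmono : ∀ i ∈ t, MonotoneOn (f i) s)
    (hconv : ∀ i ∈ t, ConvexOn ℝ s (f i)) :
    ConvexOn ℝ s (fun x => ∏ i ∈ t, f i x) := by
  classical
  induction t using Finset.induction_on with
  | empty => simpa using convexOn_const (1 : ℝ) hs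
  | insert a t ha ih =>
    simp only [Finset.forall_mem_insert] at h0 hmono hconv
    have hmono' : MonotoneOn (fun x => ∏ i ∈ t, f i x) s := fun x hx y hy hxy =>
      Finset.prod_le_prod (fun i hi => h0.2 i hi x hx) fun i hi => hmono.2 i hi hx hy hxy
    have := hconv.1.mul (ih h0.2 hmono.2 hconv.2) (fun x hx => h0.1 x hx)
      (fun x hx => Finset.prod_nonneg fun i hi => h0.2 i hi x hx) (hmono.1.monovaryOn hmono')
    simp only [Finset.prod_insert ha]
    exact this

/-- for positive integers `n, m` and `p₁, …, p_m ∈ [0,1)` with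
`n·∑ pᵢ² > 1`, the fixed-point equation `F(x) = x` for
`F(x) = ∏ᵢ (1 - pᵢ·(1 - (1 - pᵢ·(1-x))^n))` has a unique solution `ρ ∈ [0,1)`. -/
theorem unique_fixed_point_Ico (n m : ℕ) (hn : 0 < n) (hm : 0 < m)
    (p : Fin m → ℝ) (hp0 : ∀ i, 0 ≤ p i) (hp1 : ∀ i, p i < 1)
    (hsum : 1 < (n : ℝ) * ∑ i, p i ^ 2) :
    ∃! ρ : ℝ, ρ ∈ Set.Ico (0 : ℝ) 1 ∧
      (∏ i, (1 - p i * (1 - (1 - p i * (1 - ρ)) ^ n))) = ρ := by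
  have base_nonneg : ∀ i, ∀ x ∈ Set.Icc (0 : ℝ) 1, 0 ≤ 1 - p i * (1 - x) := fun i x hx => by
    nlinarith [hp0 i, hp1 i, hx.1, hx.2, mul_nonneg (hp0 i) hx.1]
  have factor_pos : ∀ i, ∀ x ∈ Set.Icc (0 : ℝ) 1,
      0 < 1 - p i * (1 - (1 - p i * (1 - x)) ^ n) := fun i x hx => by
    nlinarith [hp1 i, mul_nonneg (hp0 i) (pow_nonneg (base_nonneg i x hx) n)]
  refine ConvexOn.existsUnique_fixed_point_Ico
    (f := fun x => ∏ i, (1 - p i * (1 - (1 - p i * (1 - x)) ^ n)))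
    (d := n * ∑ i, p i ^ 2) ?_ (by fun_prop) ?_ (by simp) ?_ hsum
  · refine convexOn_prod_of_monotoneOn (convex_Icc 0 1) _ (fun i _ x hx => (factor_pos i x hx).le)
      (fun i _ x hx y hy hxy => ?_) fun i _ => ?_
    · have h := hp0 i
      have hb := base_nonneg i x hx
      gcongr
    · have hbase : ConvexOn ℝ (Set.Icc (0 : ℝ) 1) (fun x => 1 - p i * (1 - x)) := by
        refine ⟨convex_Icc 0 1, fun x _ y _ a b _ _ hab => le_of_eq ?_⟩
        simp only [smul_eq_mul]
        linear_combination (p i - 1) * hab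
      have := ((hbase.pow (fun x hx => base_nonneg i x hx) n).smul (hp0 i)).add_const (1 - p i)
      refine this.congr fun x _ => ?_
      simp only [Pi.add_apply, Pi.pow_apply, smul_eq_mul]
      ring
  · exact Finset.prod_pos fun i _ => factor_pos i 0 (by simp)
  · have hfactor : ∀ i ∈ Finset.univ, HasDerivAt
        (fun x : ℝ => 1 - p i * (1 - (1 - p i * (1 - x)) ^ n)) (n * p i ^ 2) 1 := fun i _ => by
      have := (((((((hasDerivAt_id (1 : ℝ)).const_sub 1).const_mul (p i)).const_sub 1).fun_pow
        n).const_sub 1).const_mul (p i)).const_sub 1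
      refine this.congr_deriv ?_
      simp
      ring
    refine (HasDerivAt.fun_finsetProd hfactor).congr_deriv ?_
    simp [Finset.mul_sum]
end

section
/- Let (x_i)_{i≥0} and (y_i)_{i≥0} be sequences of nonnegative reals with ∑_{i≥0} x_i = ∑_{i≥0} y_i = 1 and equal finite means ∑_{i≥0} i·x_i = ∑_{i≥0} i·y_i < ∞. Suppose x_0 ≥ y_0 and there exists an integer l ≥ 1 such that x_i ≤ y_i for all i with 1 ≤ i ≤ l, and x_i ≥ y_i for all i > l. Then for every z ∈ [0,1], ∑_{i≥0} x_i·z^i ≥ ∑_{i≥0} y_i·z^i. -/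
theorem mul_pow_mul_one_sub_le_one_sub_pow {z : ℝ} (hz0 : 0 ≤ z) (hz1 : z ≤ 1) (n : ℕ) :
    n * z ^ n * (1 - z) ≤ 1 - z ^ n := by
  induction n with
  | zero => simp
  | succ n ih =>
    have h₁ := mul_le_mul_of_nonneg_left ih hz0
    have h₂ : 0 ≤ (1 - z) * (1 - z ^ (n + 1)) :=
      mul_nonneg (by linarith) (by linarith [pow_le_one₀ (n := n + 1) hz0 hz1])
    push_cast
    rw [pow_succ] at *
    linarith

/-- On `[0,1]` the ratio `(1 - z ^ n) / n` is antitone in `n`. -/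
theorem mul_one_sub_pow_le_mul_one_sub_pow {z : ℝ} (hz0 : 0 ≤ z) (hz1 : z ≤ 1) {m n : ℕ}
    (hmn : m ≤ n) : m * (1 - z ^ n) ≤ n * (1 - z ^ m) := by
  induction n, hmn using Nat.le_induction with
  | base => rfl
  | succ n hmn ih =>
    have h₁ : m * z ^ n * (1 - z) ≤ m * z ^ m * (1 - z) :=
      mul_le_mul_of_nonneg_right
        (mul_le_mul_of_nonneg_left (pow_le_pow_of_le_one hz0 hz1 hmn) m.cast_nonneg)
        (by linarith)
    have h₂ := mul_pow_mul_one_sub_le_one_sub_pow hz0 hz1 m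
    push_cast
    rw [pow_succ]
    linarith

/-- The generating function of a summable nonnegative sequence with finite mean, combined with
its total mass and mean against the chord of `i ↦ z ^ i` through `0` and `l`. -/
theorem hasSum_mul_pow_sub_chord {x : ℕ → ℝ} (hx0 : ∀ i, 0 ≤ x i) (hx : Summable x)
    (hxs : Summable fun i : ℕ => (i : ℝ) * x i) {z : ℝ} (hz0 : 0 ≤ z) (hz1 : z ≤ 1) (l : ℕ) :
    HasSum (fun i : ℕ => x i * (i * (1 - z ^ l) - l * (1 - z ^ i)))
      ((∑' i : ℕ, (i : ℝ) * x i) * (1 - z ^ l)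
        - l * (∑' i, x i - ∑' i : ℕ, x i * z ^ i)) := by
  have hxz : Summable fun i : ℕ => x i * z ^ i :=
    Summable.of_nonneg_of_le (fun i => mul_nonneg (hx0 i) (pow_nonneg hz0 i))
      (fun i => mul_le_of_le_one_right (hx0 i) (pow_le_one₀ hz0 hz1)) hx
  have h : (fun i : ℕ => x i * (i * (1 - z ^ l) - l * (1 - z ^ i))) =
      fun i : ℕ => (i : ℝ) * x i * (1 - z ^ l) - l * (x i - x i * z ^ i) := by
    ext i
    ring
  rw [h]
  exact (hxs.hasSum.mul_right (1 - z ^ l)).sub ((hx.hasSum.sub hxz.hasSum).mul_left (l : ℝ))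

/-- if `(xᵢ)` and `(yᵢ)` are probability distributions on ℕ with equal
finite means, `x₀ ≥ y₀`, and there is `l ≥ 1` with `xᵢ ≤ yᵢ` for `1 ≤ i ≤ l` and
`xᵢ ≥ yᵢ` for `i > l`, then the generating function of `x` dominates that of `y`
on `[0,1]`. -/
theorem pgf_domination (x y : ℕ → ℝ)
    (hx0 : ∀ i, 0 ≤ x i) (hy0 : ∀ i, 0 ≤ y i)
    (hx1 : ∑' i, x i = 1) (hy1 : ∑' i, y i = 1)
    (hxs : Summable fun i : ℕ => (i : ℝ) * x i)
    (hys : Summable fun i : ℕ => (i : ℝ) * y i)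
    (hmean : ∑' i : ℕ, (i : ℝ) * x i = ∑' i : ℕ, (i : ℝ) * y i)
    (h0 : y 0 ≤ x 0)
    (l : ℕ) (hl : 1 ≤ l)
    (hle : ∀ i : ℕ, 1 ≤ i → i ≤ l → x i ≤ y i)
    (hge : ∀ i : ℕ, l < i → y i ≤ x i) :
    ∀ z ∈ Set.Icc (0 : ℝ) 1, ∑' i : ℕ, y i * z ^ i ≤ ∑' i : ℕ, x i * z ^ i := by
  rintro z ⟨hz0, hz1⟩
  have hxsum : Summable x := by
    by_contra h
    simp [tsum_eq_zero_of_not_summable h] at hx1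
  have hysum : Summable y := by
    by_contra h
    simp [tsum_eq_zero_of_not_summable h] at hy1
  have key := hasSum_le (fun i => ?_) (hasSum_mul_pow_sub_chord hy0 hysum hys hz0 hz1 l)
    (hasSum_mul_pow_sub_chord hx0 hxsum hxs hz0 hz1 l)
  · rw [hmean, hx1, hy1] at key
    have hl' : (0 : ℝ) < l := by exact_mod_cast hl
    exact le_of_mul_le_mul_left (by linarith) hl'
  · rcases Nat.eq_zero_or_pos i with rfl | hi
    · simp
    rcases le_or_gt i l with h | h
    · exact mul_le_mul_of_nonpos_right (hle i hi h)
        (sub_nonpos.2 (mul_one_sub_pow_le_mul_one_sub_pow hz0 hz1 h))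
    · exact mul_le_mul_of_nonneg_right (hge i h)
        (sub_nonneg.2 (mul_one_sub_pow_le_mul_one_sub_pow hz0 hz1 h.le))
end

section
/- Let c ∈ (0,1), let n ≥ 3 and k be positive integers with k ≥ 15·(log n)/(1−c)², and let q ∈ [0,1] satisfy q ≤ (1+c)·k/(2n). If X is a binomial random variable with parameters n and q, then P[X ≥ k−1] ≤ exp( −(1−c)²·k / (5·(2+c)) ). -/
open MeasureTheory

/-- The Bernoulli measure on `Bool` with success probability `p`. -/
noncomputable def bernoulliBool (p : ℝ) : Measure Bool :=
  ENNReal.ofReal p • Measure.dirac true + ENNReal.ofReal (1 - p) • Measure.dirac false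

instance (p : ℝ) : IsFiniteMeasure (bernoulliBool p) := by
  constructor
  simp only [bernoulliBool, Measure.coe_add, Measure.smul_apply, Pi.add_apply,
    smul_eq_mul, measure_univ, mul_one]
  exact ENNReal.add_lt_top.mpr ⟨ENNReal.ofReal_lt_top, ENNReal.ofReal_lt_top⟩

theorem integral_bernoulliBool {q : ℝ} (hq0 : 0 ≤ q) (hq1 : q ≤ 1) (f : Bool → ℝ) :
    ∫ b, f b ∂(bernoulliBool q) = q * f true + (1 - q) * f false := by
  rw [integral_fintype (.of_finite)]
  simp [bernoulliBool, Measure.real, hq0, sub_nonneg.mpr hq1]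

/-- The probability generating function of the number of successes. -/
theorem integral_pow_card_pi_bernoulliBool {q : ℝ} (hq0 : 0 ≤ q) (hq1 : q ≤ 1) (n : ℕ) (r : ℝ) :
    ∫ ω, r ^ Nat.card {i : Fin n // ω i = true} ∂(Measure.pi fun _ : Fin n => bernoulliBool q) =
      (1 + q * (r - 1)) ^ n := by
  have hcard (ω : Fin n → Bool) : r ^ Nat.card {i : Fin n // ω i = true} =
      ∏ i, (fun b : Bool => if b then r else 1) (ω i) := by
    rw [Nat.card_eq_fintype_card, Fintype.card_subtype]
    simp [Finset.prod_ite]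
  simp_rw [hcard]
  rw [integral_fintype_prod_eq_prod (fun (_ : Fin n) (b : Bool) => if b then r else (1 : ℝ))]
  simp only [integral_bernoulliBool hq0 hq1]
  simp
  ring

/-- The exponential Markov inequality for the binomial upper tail. -/
theorem pow_mul_pi_bernoulliBool_real_le {q : ℝ} (hq0 : 0 ≤ q) (hq1 : q ≤ 1) (n a : ℕ) {r : ℝ}
    (hr : 1 ≤ r) :
    r ^ a * (Measure.pi fun _ : Fin n => bernoulliBool q).real
        {ω | a ≤ Nat.card {i : Fin n // ω i = true}} ≤ (1 + q * (r - 1)) ^ n := by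
  rw [← integral_pow_card_pi_bernoulliBool hq0 hq1]
  refine le_trans ?_ (mul_meas_ge_le_integral_of_nonneg
    (.of_forall fun _ => pow_nonneg (zero_le_one.trans hr) _) (.of_finite) (r ^ a))
  refine mul_le_mul_of_nonneg_left (measureReal_mono fun ω hω => ?_)
    (pow_nonneg (zero_le_one.trans hr) _)
  exact pow_le_pow_right₀ hr hω

theorem one_le_log_of_three_le {x : ℝ} (hx : 3 ≤ x) : 1 ≤ Real.log x := by
  rw [Real.le_log_iff_exp_le (by linarith)]
  linarith [Real.exp_one_lt_three]

/-- The Chernoff exponent at the tilt `1 + (1 - c) / (1 + c)`. -/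
theorem chernoff_exponent_le {c k : ℝ} (hc0 : 0 < c) (hc1 : c < 1) (hk : 15 ≤ (1 - c) ^ 2 * k) :
    (1 - c) * k / 2 - (k - 1) * Real.log (1 + (1 - c) / (1 + c)) ≤
      -((1 - c) ^ 2 * k) / (5 * (2 + c)) := by
  have hd : 0 < 1 - c := sub_pos.mpr hc1
  have hk0 : 0 < k := pos_of_mul_pos_right (by linarith) (sq_nonneg (1 - c))
  have hdk : 15 ≤ (1 - c) * k := by nlinarith [mul_pos hd hk0]
  have hk1 : 0 ≤ k - 1 := by nlinarith
  have hlog : 2 * (1 - c) / (3 + c) ≤ Real.log (1 + (1 - c) / (1 + c)) := by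
    convert Real.le_log_one_add_of_nonneg (x := (1 - c) / (1 + c)) (by positivity) using 1
    field_simp
    ring
  have hmul := mul_le_mul_of_nonneg_left hlog hk1
  have hrat : (1 - c) * k / 2 - (k - 1) * (2 * (1 - c) / (3 + c)) =
      (1 - c) * (4 - (1 - c) * k) / (2 * (3 + c)) := by
    field_simp
    ring
  suffices (1 - c) * (4 - (1 - c) * k) / (2 * (3 + c)) ≤ -((1 - c) ^ 2 * k) / (5 * (2 + c)) by
    linarith
  rw [div_le_div_iff₀ (by positivity) (by positivity)]
  have key : (4 - (1 - c) * k) * (5 * (2 + c)) ≤ -((1 - c) * k) * (2 * (3 + c)) := by nlinarith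
  nlinarith [mul_le_mul_of_nonneg_left key hd.le]

/-- Chernoff bound for the binomial: let `0 < c < 1`, `n ≥ 3`,
`k ≥ 15·log n/(1-c)²` and `q ≤ (1+c)·k/(2n)`. If `X ~ Bin(n, q)` (realized as the
number of successes among `n` independent Bernoulli(q) trials), then
`P[X ≥ k-1] ≤ exp(-(1-c)²·k/(5·(2+c)))`. -/
theorem binomial_upper_tail (c : ℝ) (hc0 : 0 < c) (hc1 : c < 1)
    (n k : ℕ) (hn : 3 ≤ n) (hk0 : 0 < k)
    (hk : 15 * Real.log n / (1 - c) ^ 2 ≤ (k : ℝ))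
    (q : ℝ) (hq0 : 0 ≤ q) (hq1 : q ≤ 1)
    (hq : q ≤ (1 + c) * k / (2 * n)) :
    (Measure.pi fun _ : Fin n => bernoulliBool q)
      {ω | (k : ℝ) - 1 ≤ (Nat.card {i : Fin n // ω i = true} : ℝ)} ≤
      ENNReal.ofReal (Real.exp (-((1 - c) ^ 2 * k) / (5 * (2 + c)))) := by
  have hn' : (3 : ℝ) ≤ n := by exact_mod_cast hn
  have hk15 : 15 ≤ (1 - c) ^ 2 * k := by
    rw [div_le_iff₀ (pow_pos (sub_pos.mpr hc1) 2)] at hk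
    linarith [one_le_log_of_three_le hn']
  set e : ℝ := (1 - c) / (1 + c) with he
  have he0 : 0 ≤ e := div_nonneg (by linarith) (by linarith)
  have hset : {ω : Fin n → Bool | (k : ℝ) - 1 ≤ (Nat.card {i : Fin n // ω i = true} : ℝ)} =
      {ω | k - 1 ≤ Nat.card {i : Fin n // ω i = true}} := by
    ext ω
    simp only [Set.mem_ofPred_eq]
    rw [← Nat.cast_pred hk0, Nat.cast_le]
  have hmarkov := pow_mul_pi_bernoulliBool_real_le hq0 hq1 n (k - 1) (r := 1 + e) (by linarith)
  have hmgf : (1 + q * (1 + e - 1)) ^ n ≤ Real.exp ((1 - c) * k / 2) := by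
    have hmean : n * (q * e) ≤ (1 - c) * k / 2 := by
      calc n * (q * e) ≤ n * ((1 + c) * k / (2 * n) * e) := by gcongr
        _ = (1 - c) * k / 2 := by
          rw [he]
          field_simp
    calc (1 + q * (1 + e - 1)) ^ n ≤ Real.exp (q * e) ^ n := by
          refine pow_le_pow_left₀ (by rw [add_sub_cancel_left]; positivity) ?_ n
          linarith [Real.add_one_le_exp (q * e)]
      _ = Real.exp (n * (q * e)) := (Real.exp_nat_mul _ n).symm
      _ ≤ _ := Real.exp_le_exp.mpr hmean
  have hpow : (1 + e) ^ (k - 1) = Real.exp (((k : ℝ) - 1) * Real.log (1 + e)) := by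
    rw [← Nat.cast_pred hk0, Real.exp_nat_mul, Real.exp_log (by linarith)]
  rw [hset, ← ofReal_measureReal]
  refine ENNReal.ofReal_le_ofReal (le_trans ?_
    (Real.exp_le_exp.mpr (chernoff_exponent_le hc0 hc1 hk15)))
  rw [Real.exp_sub, ← he, ← hpow, le_div_iff₀ (by positivity), mul_comm]
  exact hmarkov.trans hmgf
end

section
/- Let k, m, n be positive integers, let p_1, …, p_m ∈ [0,1] with p = max_j p_j > 0, and suppose n·∑_{j=1}^m p_j² = c with c > 1. Let I_1, …, I_m be independent Bernoulli random variables where I_j equals 1 with probability 1 − (1 − p_j)^k, and set S = ∑_{j=1}^m p_j·I_j. Then P[ S ≤ E[S] − (c−1)·k/(3n) ] ≤ exp( −(c−1)²·k / (18·c·p·n) ), where E[S] = ∑_{j=1}^m p_j·(1 − (1 − p_j)^k). -/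
open MeasureTheory

/-- Maximum of the attribute probabilities. -/
noncomputable def pmax {m : ℕ} (p : Fin m → ℝ) : ℝ := ⨆ j, p j

theorem exp_neg_le_quadratic {x : ℝ} (hx : 0 ≤ x) : Real.exp (-x) ≤ 1 - x + x ^ 2 / 2 := by
  rw [Real.exp_neg, inv_le_iff_one_le_mul₀ (Real.exp_pos x)]
  nlinarith [Real.quadratic_le_exp_of_nonneg hx, sq_nonneg (x - 1), sq_nonneg (x ^ 2),
    mul_le_mul_of_nonneg_left (Real.quadratic_le_exp_of_nonneg hx)
      (show 0 ≤ 1 - x + x ^ 2 / 2 by nlinarith [sq_nonneg (x - 1)])]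

theorem lintegral_bernoulliBool_exp_le {q x : ℝ} (hq0 : 0 ≤ q) (hq1 : q ≤ 1) (hx : 0 ≤ x) :
    ∫⁻ b, ENNReal.ofReal (Real.exp (-(x * if b = true then 1 else 0))) ∂bernoulliBool q ≤
      ENNReal.ofReal (Real.exp (q * (-x + x ^ 2 / 2))) := by
  rw [bernoulliBool, lintegral_add_measure, lintegral_smul_measure, lintegral_smul_measure,
    lintegral_dirac, lintegral_dirac, smul_eq_mul, smul_eq_mul,
    ← ENNReal.ofReal_mul hq0, ← ENNReal.ofReal_mul (sub_nonneg.2 hq1),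
    ← ENNReal.ofReal_add (by positivity) (mul_nonneg (sub_nonneg.2 hq1) (Real.exp_pos _).le)]
  refine ENNReal.ofReal_le_ofReal (le_trans ?_ (Real.add_one_le_exp _))
  simp only [if_true, mul_one, Bool.false_eq_true, if_false, mul_zero, neg_zero, Real.exp_zero]
  linarith [mul_le_mul_of_nonneg_left (exp_neg_le_quadratic hx) hq0]

theorem lintegral_pi_prod_of_finite {ι α : Type*} [Fintype ι] [Fintype α] [MeasurableSpace α]
    [MeasurableSingletonClass α] (μ : ι → Measure α) [∀ i, SigmaFinite (μ i)]
    (f : ι → α → ENNReal) :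
    ∫⁻ x, ∏ i, f i (x i) ∂Measure.pi μ = ∏ i, ∫⁻ a, f i a ∂μ i := by
  classical
  simp_rw [lintegral_fintype, Measure.pi_singleton, ← Finset.prod_mul_distrib]
  rw [Finset.prod_univ_sum, Fintype.piFinset_univ]

/-- Chernoff bound for the lower tail of a nonnegative combination of independent Bernoulli
variables. -/
theorem pi_bernoulliBool_lower_tail_le {ι : Type*} [Fintype ι] (p q : ι → ℝ)
    (hp : ∀ j, 0 ≤ p j) (hq0 : ∀ j, 0 ≤ q j) (hq1 : ∀ j, q j ≤ 1) {s : ℝ} (hs : 0 ≤ s) (t : ℝ) :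
    (Measure.pi fun j => bernoulliBool (q j))
      {ω | ∑ j, p j * (if ω j = true then 1 else 0) ≤ (∑ j, p j * q j) - t} ≤
      ENNReal.ofReal (Real.exp (-(s * t) + s ^ 2 / 2 * ∑ j, p j ^ 2 * q j)) := by
  set μ := Measure.pi fun j => bernoulliBool (q j)
  set A := {ω : ι → Bool | ∑ j, p j * (if ω j = true then 1 else 0) ≤ (∑ j, p j * q j) - t}
  set a := (∑ j, p j * q j) - t with ha
  have hA : MeasurableSet A := A.toFinite.measurableSet
  calc μ A = ∫⁻ ω, A.indicator 1 ω ∂μ := (lintegral_indicator_one hA).symm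
    _ ≤ ∫⁻ ω, ENNReal.ofReal (Real.exp (s * a)) * ∏ j,
          ENNReal.ofReal (Real.exp (-(s * p j * if ω j = true then 1 else 0))) ∂μ := by
        refine lintegral_mono (Set.indicator_le fun ω hω => ?_)
        rw [← ENNReal.ofReal_prod_of_nonneg (fun _ _ => (Real.exp_pos _).le), ← Real.exp_sum,
          ← ENNReal.ofReal_mul (Real.exp_pos _).le, ← Real.exp_add, Pi.one_apply,
          ENNReal.one_le_ofReal, Real.one_le_exp_iff, Finset.sum_neg_distrib]
        simp_rw [mul_assoc]
        rw [← Finset.mul_sum]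
        linarith [mul_le_mul_of_nonneg_left (show _ ≤ a from hω) hs]
    _ = ENNReal.ofReal (Real.exp (s * a)) * ∏ j, ∫⁻ b,
          ENNReal.ofReal (Real.exp (-(s * p j * if b = true then 1 else 0)))
            ∂bernoulliBool (q j) := by
        rw [lintegral_const_mul _ (measurable_of_finite _)]
        congr 1
        exact lintegral_pi_prod_of_finite (fun j => bernoulliBool (q j)) fun j b =>
          ENNReal.ofReal (Real.exp (-(s * p j * if b = true then 1 else 0)))
    _ ≤ ENNReal.ofReal (Real.exp (s * a)) *
          ∏ j, ENNReal.ofReal (Real.exp (q j * (-(s * p j) + (s * p j) ^ 2 / 2))) := by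
        gcongr with j
        exact lintegral_bernoulliBool_exp_le (hq0 j) (hq1 j) (mul_nonneg hs (hp j))
    _ = ENNReal.ofReal (Real.exp (-(s * t) + s ^ 2 / 2 * ∑ j, p j ^ 2 * q j)) := by
        rw [← ENNReal.ofReal_prod_of_nonneg (fun _ _ => (Real.exp_pos _).le), ← Real.exp_sum,
          ← ENNReal.ofReal_mul (Real.exp_pos _).le, ← Real.exp_add]
        congr 2
        rw [ha, mul_sub, Finset.mul_sum, Finset.mul_sum, sub_add_eq_add_sub,
          ← Finset.sum_add_distrib, sub_eq_neg_add]
        congr 1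
        exact Finset.sum_congr rfl fun j _ => by ring

theorem one_sub_one_sub_pow_le {x : ℝ} (hx : x ≤ 1) (k : ℕ) : 1 - (1 - x) ^ k ≤ k * x := by
  have h := one_add_mul_le_pow (show (-2 : ℝ) ≤ -x by linarith) k
  rw [← sub_eq_add_neg] at h
  linarith

/-- lower tail for the discovered weight: let `I_j` be independent
Bernoulli indicators with success probabilities `1 - (1 - p_j)^k`, and
`S = ∑ p_j·I_j`. If `n·∑ p_j² = c > 1` and `p = max p_j > 0`, then
`P[S ≤ E[S] - (c-1)·k/(3n)] ≤ exp(-(c-1)²·k/(18·c·p·n))`. -/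
theorem discovered_weight_lower_tail (k m n : ℕ) (hk : 0 < k) (hm : 0 < m) (hn : 0 < n)
    (p : Fin m → ℝ) (hp0 : ∀ j, 0 ≤ p j) (hp1 : ∀ j, p j ≤ 1)
    (hpmax : 0 < pmax p)
    (c : ℝ) (hc : 1 < c)
    (hc' : (n : ℝ) * ∑ j, p j ^ 2 = c) :
    (Measure.pi fun j : Fin m => bernoulliBool (1 - (1 - p j) ^ k))
      {ω | ∑ j : Fin m, p j * (if ω j = true then 1 else 0) ≤
        (∑ j : Fin m, p j * (1 - (1 - p j) ^ k)) - (c - 1) * k / (3 * n)} ≤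
      ENNReal.ofReal (Real.exp (-((c - 1) ^ 2 * k) / (18 * c * pmax p * n))) := by
  have hq0 : ∀ j, 0 ≤ 1 - (1 - p j) ^ k := fun j =>
    sub_nonneg.2 (pow_le_one₀ (sub_nonneg.2 (hp1 j)) (by linarith [hp0 j]))
  have hq1 : ∀ j, 1 - (1 - p j) ^ k ≤ 1 := fun j =>
    sub_le_self _ (pow_nonneg (sub_nonneg.2 (hp1 j)) k)
  have hn' : (0 : ℝ) < n := by exact_mod_cast hn
  have hk' : (0 : ℝ) < k := by exact_mod_cast hk
  have hle : ∀ j, p j ≤ pmax p := fun j => le_ciSup (Set.finite_range p).bddAbove j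
  have hvar : ∑ j, p j ^ 2 * (1 - (1 - p j) ^ k) ≤ k * pmax p * c / n := by
    calc ∑ j, p j ^ 2 * (1 - (1 - p j) ^ k) ≤ ∑ j, p j ^ 2 * (k * pmax p) := by
          gcongr with j
          exact (one_sub_one_sub_pow_le (hp1 j) k).trans (by gcongr; exact hle j)
      _ = k * pmax p * c / n := by
          rw [← Finset.sum_mul, ← hc']
          field_simp
  have hs : 0 ≤ (c - 1) / (3 * pmax p * c) :=
    div_nonneg (by linarith) (mul_nonneg (by linarith) (by linarith))
  refine (pi_bernoulliBool_lower_tail_le p _ hp0 hq0 hq1 hs _).trans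
    (ENNReal.ofReal_le_ofReal (Real.exp_le_exp.2 ?_))
  refine (add_le_add_right (mul_le_mul_of_nonneg_left hvar (by positivity)) _).trans_eq ?_
  have hc0 : c ≠ 0 := by linarith
  field_simp
  ring
end

section
/- Let a, b > 0 be real numbers with a·b > 1. Then the equation exp( a·( exp(b·(x−1)) − 1 ) ) = x has a unique solution ζ* in the open interval (0,1). -/
open Set Filter Topology

/-- The compound Poisson generating function is strictly convex. -/
theorem strictConvexOn_compound_poisson_pgf {a b : ℝ} (ha : 0 < a) (hb : 0 < b) :
    StrictConvexOn ℝ univ fun x : ℝ ↦ Real.exp (a * (Real.exp (b * (x - 1)) - 1)) := by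
  refine ⟨convex_univ, fun x _ y _ hxy s t hs ht hst ↦ ?_⟩
  simp only [smul_eq_mul]
  have hne : b * (x - 1) ≠ b * (y - 1) := fun h ↦
    hxy (sub_left_injective (mul_left_cancel₀ hb.ne' h))
  have inner := strictConvexOn_exp.2 (mem_univ _) (mem_univ _) hne hs ht hst
  have outer := convexOn_exp.2 (mem_univ (a * (Real.exp (b * (x - 1)) - 1)))
    (mem_univ (a * (Real.exp (b * (y - 1)) - 1))) hs.le ht.le hst
  simp only [smul_eq_mul] at inner outer
  refine lt_of_lt_of_le (Real.exp_lt_exp.2 ?_) outer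
  obtain rfl : t = 1 - s := by linarith
  rw [show b * (s * x + (1 - s) * y - 1) = s * (b * (x - 1)) + (1 - s) * (b * (y - 1)) by ring]
  linarith [mul_lt_mul_of_pos_left inner ha]

theorem hasDerivAt_compound_poisson_pgf_one (a b : ℝ) :
    HasDerivAt (fun x : ℝ ↦ Real.exp (a * (Real.exp (b * (x - 1)) - 1))) (a * b) 1 := by
  have h := (((((hasDerivAt_id (1 : ℝ)).sub_const 1).const_mul b).exp.sub_const 1).const_mul a).exp
  simpa using h

/-- for reals `a, b > 0` with `a·b > 1`, the equation
`exp(a·(exp(b·(x-1)) - 1)) = x` has a unique solution in the open interval `(0,1)`. -/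
theorem compound_poisson_extinction_unique (a b : ℝ) (ha : 0 < a) (hb : 0 < b)
    (hab : 1 < a * b) :
    ∃! ζ : ℝ, ζ ∈ Set.Ioo (0 : ℝ) 1 ∧
      Real.exp (a * (Real.exp (b * (ζ - 1)) - 1)) = ζ := by
  set f : ℝ → ℝ := fun x ↦ Real.exp (a * (Real.exp (b * (x - 1)) - 1)) with hf
  have hf1 : f 1 = 1 := by simp [hf]
  have not_two_fixed : ∀ x y : ℝ, x < y → y < 1 → f x = x → f y ≠ y := by
    intro x y hxy hy hx hfy
    have h := (strictConvexOn_compound_poisson_pgf ha hb).slope_strict_mono_adjacent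
      (mem_univ x) (mem_univ 1) hxy hy
    change (f y - f x) / (y - x) < (f 1 - f y) / (1 - y) at h
    rw [hf1, hfy, hx, div_self (by linarith), div_self (by linarith)] at h
    exact h.false
  have hderiv : HasDerivAt (fun x ↦ f x - x) (a * b - 1) 1 :=
    (hasDerivAt_compound_poisson_pgf_one a b).sub (hasDerivAt_id 1)
  have hsign := eventually_nhdsWithin_sign_eq_of_deriv_pos
    (show 0 < deriv (fun x ↦ f x - x) 1 by rw [hderiv.deriv]; linarith) (by simp [hf1])
  obtain ⟨c, hc, hc0, hc1⟩ : ∃ c, f c - c < 0 ∧ 0 < c ∧ c < 1 := by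
    obtain ⟨c, hc, hc01⟩ := ((hsign.filter_mono nhdsWithin_le_nhds).and
      (Ioo_mem_nhdsLT (zero_lt_one' ℝ))).exists
    refine ⟨c, ?_, hc01⟩
    rwa [sign_neg (sub_neg.2 hc01.2), sign_eq_neg_one_iff] at hc
  have hcont : ContinuousOn (fun x ↦ f x - x) (Icc 0 c) := by fun_prop
  obtain ⟨z, hz, hfz⟩ := intermediate_value_Ioo' hc0.le hcont
    ⟨hc, by simpa using Real.exp_pos _⟩
  refine ⟨z, ⟨⟨hz.1, hz.2.trans hc1⟩, sub_eq_zero.1 hfz⟩, ?_⟩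
  rintro y ⟨hy, hfy⟩
  rcases lt_trichotomy y z with h | h | h
  · exact (not_two_fixed y z h (hz.2.trans hc1) hfy (sub_eq_zero.1 hfz)).elim
  · exact h
  · exact (not_two_fixed z y h hy.2 (sub_eq_zero.1 hfz) hfy).elim
end

section
/- Fix c > 1 and let ζ be the unique solution in (0,1) of exp(c·(x−1)) = x. Let m : ℕ → ℕ be a sequence of positive integers with m(n) = o(n), and for each n with m(n)·n > c set p_n = √(c/(m(n)·n)) and let ρ_n be the unique solution in [0,1) of the equation x = [1 − p_n·(1 − (1 − p_n·(1−x))^n)]^{m(n)}. Then (1 − ρ_n)/(m(n)·p_n) → 1 − ζ as n → ∞. -/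
open Filter

/-- The chord slopes at the origin of `x ↦ 1 - exp (-k x)` are strictly decreasing. -/
theorem mul_one_sub_exp_neg_lt {k a b : ℝ} (hk : 0 < k) (ha : 0 < a) (hab : a < b) :
    a * (1 - Real.exp (-(k * b))) < b * (1 - Real.exp (-(k * a))) := by
  have hb : 0 < b := ha.trans hab
  have h := strictConvexOn_exp.2 (Set.mem_univ 0) (Set.mem_univ (-(k * b)))
    (by have := mul_pos hk hb; exact (neg_neg_of_pos this).ne')
    (show (0 : ℝ) < 1 - a / b by rw [sub_pos, div_lt_one hb]; exact hab)
    (div_pos ha hb) (by ring)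
  simp only [smul_eq_mul, mul_zero, zero_add, Real.exp_zero, mul_one] at h
  have e : a / b * -(k * b) = -(k * a) := by field_simp
  rw [e] at h
  have h2 := mul_lt_mul_of_pos_left h hb
  have e2 : b * (1 - a / b + a / b * Real.exp (-(k * b))) =
      b - a + a * Real.exp (-(k * b)) := by field_simp
  rw [e2] at h2
  linarith

theorem one_sub_pow_le_exp_neg {x : ℝ} (hx : x ≤ 1) (n : ℕ) :
    (1 - x) ^ n ≤ Real.exp (-(n * x)) := by
  calc (1 - x) ^ n ≤ Real.exp (-x) ^ n :=
        pow_le_pow_left₀ (by linarith) (Real.one_sub_le_exp_neg x) n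
    _ = Real.exp (-(n * x)) := by rw [← Real.exp_nat_mul]; ring_nf

theorem exp_neg_le_one_sub_pow {x : ℝ} (hx : x < 1) (n : ℕ) :
    Real.exp (-(n * (x / (1 - x)))) ≤ (1 - x) ^ n := by
  have h1 : 0 < 1 - x := by linarith
  have h : Real.exp (-(x / (1 - x))) ≤ 1 - x := by
    rw [Real.exp_neg]
    refine inv_le_of_inv_le₀ h1 ?_
    have e : (1 - x)⁻¹ = x / (1 - x) + 1 := by field_simp; ring
    rw [e]
    exact Real.add_one_le_exp _
  calc Real.exp (-(n * (x / (1 - x)))) = Real.exp (-(x / (1 - x))) ^ n := by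
        rw [← Real.exp_nat_mul]; ring_nf
    _ ≤ (1 - x) ^ n := pow_le_pow_left₀ (Real.exp_pos _).le h n

/-- The rescaled survival probability `y = (1 - ρ) / (m p)` approximately solves
`y = 1 - exp (-c y)`. -/
theorem rescaled_survival_bounds {c p ρ : ℝ} {n m : ℕ} (hc : 0 < c) (hcn : c < n)
    (hm : 0 < m) (hp : 0 < p) (hp1 : p ≤ 1) (hpc : m * n * p ^ 2 = c)
    (hρ : ρ ∈ Set.Ico (0 : ℝ) 1)
    (heq : ρ = (1 - p * (1 - (1 - p * (1 - ρ)) ^ n)) ^ m) :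
    0 < (1 - ρ) / (m * p) ∧
    1 - Real.exp (-(c * ((1 - ρ) / (m * p)))) ≤ (1 + m * p) * ((1 - ρ) / (m * p)) ∧
    (1 - ρ) / (m * p) ≤ 1 - Real.exp (-(c / (1 - c / n) * ((1 - ρ) / (m * p)))) := by
  obtain ⟨hρ0, hρ1⟩ := hρ
  have hm' : (0 : ℝ) < m := by exact_mod_cast hm
  have hn' : (0 : ℝ) < n := hc.trans hcn
  have hδ : 0 < m * p := mul_pos hm' hp
  set y := (1 - ρ) / (m * p) with hy
  have hy0 : 0 < y := div_pos (by linarith) hδ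
  have hs : 1 - ρ = m * p * y := by rw [hy]; field_simp
  set u := p * (1 - ρ) with hu
  have hnu : n * u = c * y := by rw [hu, hs, ← hpc]; ring
  have hu0 : 0 ≤ u := mul_nonneg hp.le (by linarith)
  have hu1 : u ≤ 1 := mul_le_one₀ hp1 (by linarith) (by linarith)
  set q := 1 - (1 - u) ^ n with hq
  have hq1 : q ≤ 1 := by
    have := pow_nonneg (sub_nonneg.2 hu1) n
    linarith
  have hq0 : 0 ≤ q := by
    have := pow_le_one₀ (n := n) (sub_nonneg.2 hu1) (by linarith)
    linarith
  have hpq : p * q ≤ 1 := mul_le_one₀ hp1 hq0 hq1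
  have hyq : y ≤ q := by
    have h := one_add_mul_le_pow (a := -(p * q)) (by linarith) m
    rw [← sub_eq_add_neg, ← heq] at h
    exact le_of_mul_le_mul_left (by linarith) hδ
  have hqy : q ≤ (1 + m * p) * y := by
    have h := one_sub_pow_le_exp_neg hpq m
    rw [← heq] at h
    set t := (m : ℝ) * (p * q) with ht
    have ht0 : 0 ≤ t := by positivity
    have h2 : Real.exp (-t) ≤ 1 / (1 + t) := by
      rw [Real.exp_neg, ← one_div]
      exact one_div_le_one_div_of_le (by linarith) (by linarith [Real.add_one_le_exp t])
    have h3 : ρ * (1 + t) ≤ 1 := (le_div_iff₀ (by linarith)).1 (h.trans h2)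
    have h4 : t ≤ (1 + t) * (m * p * y) := by rw [← hs]; linarith
    have h5 : t ≤ m * p := by
      rw [ht, ← mul_assoc]; exact mul_le_of_le_one_right hδ.le hq1
    have h6 : (1 + t) * (m * p * y) ≤ (1 + m * p) * (m * p * y) := by gcongr
    refine le_of_mul_le_mul_left ?_ hδ
    linarith
  refine ⟨hy0, ?_, ?_⟩
  · have h := one_sub_pow_le_exp_neg hu1 n
    rw [hnu] at h
    linarith
  · have hun : u ≤ c / n := by
      rw [le_div_iff₀ hn', mul_comm, hnu]
      exact mul_le_of_le_one_right hc.le (hyq.trans hq1)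
    have hcn1 : c / n < 1 := (div_lt_one hn').2 hcn
    have h := exp_neg_le_one_sub_pow (hun.trans_lt hcn1) n
    have h2 : n * (u / (1 - u)) ≤ c / (1 - c / n) * y := by
      calc n * (u / (1 - u)) = c * y / (1 - u) := by rw [← hnu]; ring
        _ ≤ c * y / (1 - c / n) := by
          apply div_le_div_of_nonneg_left (by positivity) (by linarith) (by linarith)
        _ = c / (1 - c / n) * y := by ring
    have h3 := Real.exp_le_exp.2 (neg_le_neg h2)
    linarith

/-- homogeneous case, `m = o(n)`: fix `c > 1` and let `ζ` be the
solution in `(0,1)` of `exp(c·(x-1)) = x`. If `m(n)` is a sequence of positive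
integers with `m(n) = o(n)`, `p_n = √(c/(m(n)·n))`, and `ρ_n ∈ [0,1)` solves
`x = (1 - p_n·(1 - (1 - p_n·(1-x))^n))^{m(n)}` for every `n` with `m(n)·n > c`, then
`(1 - ρ_n)/(m(n)·p_n) → 1 - ζ`. -/
theorem extinction_asymptotics_m_small (c : ℝ) (hc : 1 < c)
    (ζ : ℝ) (hζ : ζ ∈ Set.Ioo (0 : ℝ) 1) (hζeq : Real.exp (c * (ζ - 1)) = ζ)
    (m : ℕ → ℕ) (hm : ∀ n, 0 < m n)
    (hmo : (fun n => (m n : ℝ)) =o[atTop] fun n => (n : ℝ))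
    (ρ : ℕ → ℝ)
    (hρ : ∀ n : ℕ, c < (m n : ℝ) * n →
      ρ n ∈ Set.Ico (0 : ℝ) 1 ∧
      ρ n = (1 - Real.sqrt (c / (m n * n)) *
        (1 - (1 - Real.sqrt (c / (m n * n)) * (1 - ρ n)) ^ n)) ^ m n) :
    Tendsto (fun n => (1 - ρ n) / (m n * Real.sqrt (c / (m n * n)))) atTop
      (nhds (1 - ζ)) := by
  have hc0 : 0 < c := by linarith
  obtain ⟨hζ0, hζ1⟩ := hζ
  set z := 1 - ζ with hz
  have hz0 : 0 < z := by linarith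
  have hfix : 1 - Real.exp (-(c * z)) = z := by
    rw [show -(c * z) = c * (ζ - 1) by rw [hz]; ring, hζeq]
  have hcn : ∀ᶠ n : ℕ in atTop, c < n := tendsto_natCast_atTop_atTop.eventually_gt_atTop c
  have hinv : Tendsto (fun n : ℕ => c / (n : ℝ)) atTop (nhds 0) :=
    tendsto_const_div_atTop_nhds_zero_nat c
  have hδ : Tendsto (fun n : ℕ => (m n : ℝ) * Real.sqrt (c / (m n * n))) atTop (nhds 0) := by
    have h1 : Tendsto (fun n : ℕ => Real.sqrt (c * ((m n : ℝ) / n))) atTop (nhds 0) := by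
      simpa using (hmo.tendsto_div_nhds_zero.const_mul c).sqrt
    refine h1.congr fun n => ?_
    have hm' : (0 : ℝ) < m n := by exact_mod_cast hm n
    rw [show c * ((m n : ℝ) / n) = (m n : ℝ) ^ 2 * (c / (m n * n)) by field_simp,
      Real.sqrt_mul (sq_nonneg _), Real.sqrt_sq hm'.le]
  have hbounds : ∀ᶠ n : ℕ in atTop, _ := hcn.mono fun n hn => by
    have hm' : (1 : ℝ) ≤ m n := by exact_mod_cast hm n
    have hn0 : (0 : ℝ) < n := hc0.trans hn
    have hmn : c < (m n : ℝ) * n := hn.trans_le (le_mul_of_one_le_left hn0.le hm')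
    have hmn0 : (0 : ℝ) < (m n : ℝ) * n := hc0.trans hmn
    obtain ⟨hρn, hρeq⟩ := hρ n hmn
    exact rescaled_survival_bounds hc0 hn (hm n) (Real.sqrt_pos.2 (div_pos hc0 hmn0))
      (Real.sqrt_le_one.2 ((div_le_one hmn0).2 hmn.le))
      (by rw [Real.sq_sqrt (by positivity)]; field_simp) hρn hρeq
  refine tendsto_order.2 ⟨fun a ha => ?_, fun b hb => ?_⟩
  · rcases le_or_gt a 0 with ha0 | ha0
    · filter_upwards [hbounds] with n hn
      exact ha0.trans_lt hn.1
    have hlt : a < 1 - Real.exp (-(c * a)) := by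
      have h := mul_one_sub_exp_neg_lt hc0 ha0 ha
      rw [hfix, mul_comm] at h
      exact lt_of_mul_lt_mul_left h hz0.le
    have hlim : Tendsto (fun n : ℕ => (1 + (m n : ℝ) * Real.sqrt (c / (m n * n))) * a) atTop
        (nhds a) := by
      simpa using (hδ.const_add 1).mul_const a
    filter_upwards [hbounds, hlim.eventually_lt_const hlt] with n hn hna
    obtain ⟨hy0, hlow, -⟩ := hn
    by_contra! hle
    have hchord : (1 - Real.exp (-(c * a))) *
        ((1 - ρ n) / (m n * Real.sqrt (c / (m n * n)))) ≤
        a * (1 - Real.exp (-(c * ((1 - ρ n) / (m n * Real.sqrt (c / (m n * n))))))) := by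
      rcases hle.lt_or_eq with h | h
      · have := mul_one_sub_exp_neg_lt hc0 hy0 h
        linarith
      · rw [h]; linarith
    have h1 := mul_le_mul_of_nonneg_left hlow ha0.le
    have h2 := mul_lt_mul_of_pos_right hna hy0
    linarith
  · have hb0 : 0 < b := hz0.trans hb
    have hlt : 1 - Real.exp (-(c * b)) < b := by
      have h := mul_one_sub_exp_neg_lt hc0 hz0 hb
      rw [hfix, mul_comm b] at h
      exact lt_of_mul_lt_mul_left h hz0.le
    have hlim : Tendsto (fun n : ℕ => 1 - Real.exp (-(c / (1 - c / (n : ℝ)) * b))) atTop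
        (nhds (1 - Real.exp (-(c * b)))) := by
      have h : Tendsto (fun n : ℕ => c / (1 - c / (n : ℝ))) atTop (nhds c) := by
        have h := (tendsto_const_nhds (x := c)).div (hinv.const_sub 1) (by norm_num)
        rwa [sub_zero, div_one] at h
      exact ((Real.continuous_exp.tendsto _).comp (h.mul_const b).neg).const_sub 1
    filter_upwards [hbounds, hcn, hlim.eventually_lt_const hlt] with n hn hcn hnb
    obtain ⟨hy0, -, hup⟩ := hn
    by_contra! hle
    have hk : 0 < c / (1 - c / (n : ℝ)) :=
      div_pos hc0 (sub_pos.2 ((div_lt_one (hc0.trans hcn)).2 hcn))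
    have h1 := mul_le_mul_of_nonneg_left hup hb0.le
    have h2 := mul_lt_mul_of_pos_right hnb hy0
    rcases hle.lt_or_eq with h | h
    · have := mul_one_sub_exp_neg_lt hk hb0 h
      linarith
    · rw [← h] at hup
      linarith
end

section
/- Fix c > 1 and let ζ be the unique solution in (0,1) of exp(c·(x−1)) = x. Let m : ℕ → ℕ be a sequence of positive integers with n = o(m(n)), and for each n with m(n)·n > c set p_n = √(c/(m(n)·n)) and let ρ_n be the unique solution in [0,1) of the equation x = [1 − p_n·(1 − (1 − p_n·(1−x))^n)]^{m(n)}. Then ρ_n → ζ as n → ∞. -/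
open Filter

/-- The secant slope of `log` through `1`, evaluated at a fixed point of the extinction equation
with `m * n * p ^ 2 = c`, lies between `c / (1 + n * p)` and `c / (1 - c / m)`. -/
theorem log_secant_bounds_of_extinction_eq {n m : ℕ} {p c x : ℝ} (hm : 0 < m)
    (hp0 : 0 < p) (hp1 : p ≤ 1) (hc : m * n * p ^ 2 = c) (hcm : c < m)
    (hx0 : 0 ≤ x) (hx1 : x < 1)
    (hx : x = (1 - p * (1 - (1 - p * (1 - x)) ^ n)) ^ m) :
    0 < x ∧ c / (1 + n * p) ≤ Real.log x / (x - 1) ∧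
      Real.log x / (x - 1) ≤ c / (1 - c / m) := by
  obtain ⟨y, hy⟩ : ∃ y, y = 1 - x := ⟨_, rfl⟩
  obtain ⟨q, hq⟩ : ∃ q, q = 1 - (1 - p * y) ^ n := ⟨_, rfl⟩
  rw [← hy, ← hq] at hx
  have hy0 : 0 < y := by linarith
  have hy1 : y ≤ 1 := by linarith
  have hmR : (0 : ℝ) < m := by exact_mod_cast hm
  have hnR : (0 : ℝ) ≤ n := n.cast_nonneg
  have hpy0 : 0 < p * y := by positivity
  have hpy1 : p * y ≤ 1 := mul_le_one₀ hp1 hy0.le hy1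
  have hc0 : 0 ≤ c := by rw [← hc]; positivity
  have hq_le : q ≤ n * (p * y) := by
    have h := one_add_mul_le_pow (a := -(p * y)) (by linarith) n
    rw [← sub_eq_add_neg] at h
    linarith
  have hq_ge : n * (p * y) / (1 + n * (p * y)) ≤ q := by
    have hu : 0 < 1 + n * (p * y) := by positivity
    have h1 : (1 - p * y) ^ n ≤ Real.exp (-(n * (p * y))) := by
      rw [← mul_neg, Real.exp_nat_mul]
      exact pow_le_pow_left₀ (by linarith) (Real.one_sub_le_exp_neg _) n
    have h2 : Real.exp (-(n * (p * y))) ≤ (1 + n * (p * y))⁻¹ := by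
      rw [Real.exp_neg]
      exact inv_anti₀ hu (by linarith [Real.add_one_le_exp (n * (p * y))])
    have h3 : n * (p * y) / (1 + n * (p * y)) = 1 - (1 + n * (p * y))⁻¹ := by
      field_simp
      ring
    linarith
  have hcm1 : 0 < 1 - c / m := by
    have := (div_lt_one hmR).2 hcm
    linarith
  have hpq : p * q ≤ c * y / m := by
    have h := mul_le_mul_of_nonneg_left hq_le hp0.le
    have h' : p * (n * (p * y)) = c * y / m := by
      rw [← hc]
      field_simp
    linarith
  have hcy : c * y / m ≤ c / m := by
    gcongr
    exact mul_le_of_le_one_right hc0 hy1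
  have ht0 : 0 < 1 - p * q := by linarith
  have hlog : Real.log x / (x - 1) = m * -Real.log (1 - p * q) / y := by
    have hx' : Real.log x = m * Real.log (1 - p * q) := by
      rw [hx, Real.log_pow]
    rw [hx', show x - 1 = -y by linarith, div_neg, mul_neg, neg_div]
  refine ⟨hx ▸ pow_pos ht0 m, ?_, ?_⟩
  · rw [hlog, le_div_iff₀ hy0]
    have h1 := Real.log_le_sub_one_of_pos ht0
    calc c / (1 + n * p) * y = c * y / (1 + n * p) := by ring
      _ ≤ c * y / (1 + n * (p * y)) := by
        gcongr
        exact mul_le_of_le_one_right hp0.le hy1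
      _ = m * (p * (n * (p * y) / (1 + n * (p * y)))) := by
        rw [← hc]
        ring
      _ ≤ m * (p * q) := by gcongr
      _ ≤ m * -Real.log (1 - p * q) := by
        gcongr
        linarith
  · rw [hlog, div_le_iff₀ hy0]
    have h1 := Real.one_sub_inv_le_log_of_pos ht0
    have h2 : (1 - p * q)⁻¹ - 1 = p * q / (1 - p * q) := by
      field_simp
      ring
    calc m * -Real.log (1 - p * q) ≤ m * (p * q / (1 - p * q)) := by
          gcongr
          linarith
      _ ≤ m * (c * y / m / (1 - c / m)) := by
          gcongr
          linarith
      _ = c / (1 - c / m) * y := by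
          field_simp

/-- The secant slope of `log` through `1` is strictly decreasing on `(0, 1)`. -/
theorem strictAntiOn_log_div_sub_one :
    StrictAntiOn (fun x : ℝ => Real.log x / (x - 1)) (Set.Ioo 0 1) := by
  intro x hx y hy hxy
  simpa using strictConcaveOn_log_Ioi.secant_strict_mono (a := 1) (x := x) (y := y)
    (Set.mem_Ioi.2 one_pos) hx.1 hy.1 hx.2.ne hy.2.ne hxy

/-- A strictly antitone function on `(a, b)` reflects convergence of its values. -/
theorem StrictAntiOn.tendsto_of_tendsto_comp {ι : Type*} {l : Filter ι} {f : ℝ → ℝ} {a b z : ℝ}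
    (hf : StrictAntiOn f (Set.Ioo a b)) (hz : z ∈ Set.Ioo a b) {u : ι → ℝ}
    (hu : ∀ᶠ i in l, u i ∈ Set.Ioo a b)
    (h : Tendsto (fun i => f (u i)) l (nhds (f z))) : Tendsto u l (nhds z) := by
  rw [tendsto_order]
  constructor
  · intro v hv
    obtain ⟨w, hw, hwz⟩ := exists_between (max_lt hv hz.1)
    have hw' : w ∈ Set.Ioo a b := ⟨(le_max_right _ _).trans_lt hw, hwz.trans hz.2⟩
    filter_upwards [hu, h.eventually_lt_const (hf hw' hz hwz)] with i hi hlt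
    exact ((le_max_left _ _).trans_lt hw).trans ((hf.lt_iff_gt hi hw').1 hlt)
  · intro v hv
    obtain ⟨w, hzw, hw⟩ := exists_between (lt_min hv hz.2)
    have hw' : w ∈ Set.Ioo a b := ⟨hz.1.trans hzw, hw.trans_le (min_le_right _ _)⟩
    filter_upwards [hu, h.eventually_const_lt (hf hz hw' hzw)] with i hi hlt
    exact ((hf.lt_iff_gt hw' hi).1 hlt).trans (hw.trans_le (min_le_left _ _))

/-- homogeneous case, `n = o(m)`: fix `c > 1` and let `ζ` be the
solution in `(0,1)` of `exp(c·(x-1)) = x`. If `m(n)` is a sequence of positive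
integers with `n = o(m(n))`, `p_n = √(c/(m(n)·n))`, and `ρ_n ∈ [0,1)` solves
`x = (1 - p_n·(1 - (1 - p_n·(1-x))^n))^{m(n)}` for every `n` with `m(n)·n > c`, then
`ρ_n → ζ`. -/
theorem extinction_asymptotics_m_large (c : ℝ) (hc : 1 < c)
    (ζ : ℝ) (hζ : ζ ∈ Set.Ioo (0 : ℝ) 1) (hζeq : Real.exp (c * (ζ - 1)) = ζ)
    (m : ℕ → ℕ) (hm : ∀ n, 0 < m n)
    (hno : (fun n : ℕ => (n : ℝ)) =o[atTop] fun n : ℕ => (m n : ℝ))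
    (ρ : ℕ → ℝ)
    (hρ : ∀ n : ℕ, c < (m n : ℝ) * n →
      ρ n ∈ Set.Ico (0 : ℝ) 1 ∧
      ρ n = (1 - Real.sqrt (c / (m n * n)) *
        (1 - (1 - Real.sqrt (c / (m n * n)) * (1 - ρ n)) ^ n)) ^ m n) :
    Tendsto ρ atTop (nhds ζ) := by
  have hratio : Tendsto (fun n : ℕ => (n : ℝ) / m n) atTop (nhds 0) := hno.tendsto_div_nhds_zero
  have hm_top : Tendsto (fun n : ℕ => (m n : ℝ)) atTop atTop := by
    refine tendsto_atTop_mono' atTop ?_ tendsto_natCast_atTop_atTop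
    filter_upwards [hno.bound one_pos] with n hn
    simpa using hn
  have hnp : Tendsto (fun n : ℕ => (n : ℝ) * Real.sqrt (c / (m n * n))) atTop (nhds 0) := by
    have h : Tendsto (fun n : ℕ => Real.sqrt (c * (n / m n))) atTop (nhds 0) := by
      simpa using (hratio.const_mul c).sqrt
    refine h.congr fun n => ?_
    have hmn : (m n : ℝ) ≠ 0 := by exact_mod_cast (hm n).ne'
    rcases eq_or_ne (n : ℝ) 0 with h0 | h0
    · simp [h0]
    · have hsq : c * (n / m n) = (n : ℝ) ^ 2 * (c / (m n * n)) := by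
        field_simp
      rw [hsq, Real.sqrt_mul (sq_nonneg _), Real.sqrt_sq n.cast_nonneg]
  have hlower : Tendsto (fun n : ℕ => c / (1 + n * Real.sqrt (c / (m n * n)))) atTop
      (nhds c) := by
    simpa [Pi.div_def] using (tendsto_const_nhds (x := c)).div (hnp.const_add 1) (by norm_num)
  have hupper : Tendsto (fun n : ℕ => c / (1 - c / m n)) atTop (nhds c) := by
    simpa [Pi.div_def] using (tendsto_const_nhds (x := c)).div
      ((hm_top.const_div_atTop c).const_sub 1) (by norm_num)
  have hbounds : ∀ᶠ n : ℕ in atTop, ρ n ∈ Set.Ioo (0 : ℝ) 1 ∧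
      c / (1 + n * Real.sqrt (c / (m n * n))) ≤ Real.log (ρ n) / (ρ n - 1) ∧
      Real.log (ρ n) / (ρ n - 1) ≤ c / (1 - c / m n) := by
    filter_upwards [hm_top.eventually_gt_atTop c, eventually_ge_atTop 1] with n hcm hn
    have hn1 : (1 : ℝ) ≤ n := by exact_mod_cast hn
    have hmR : (0 : ℝ) < m n := by exact_mod_cast hm n
    have hmn : 0 < (m n : ℝ) * n := by positivity
    have hcmn : c < (m n : ℝ) * n := hcm.trans_le (le_mul_of_one_le_right hmR.le hn1)
    obtain ⟨⟨h0, h1⟩, heq⟩ := hρ n hcmn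
    have hdiv : 0 < c / (m n * n) := by positivity
    obtain ⟨hpos, hlo, hup⟩ := log_secant_bounds_of_extinction_eq (hm n) (Real.sqrt_pos.2 hdiv)
      (Real.sqrt_le_one.2 ((div_le_one hmn).2 hcmn.le))
      (by rw [Real.sq_sqrt hdiv.le, mul_div_cancel₀ _ hmn.ne']) hcm h0 h1 heq
    exact ⟨⟨hpos, h1⟩, hlo, hup⟩
  have hζslope : Real.log ζ / (ζ - 1) = c := by
    have hlog : Real.log ζ = c * (ζ - 1) := by
      rw [← Real.log_exp (c * (ζ - 1)), hζeq]
    rw [hlog, mul_div_cancel_right₀ _ (sub_ne_zero.2 hζ.2.ne)]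
  refine strictAntiOn_log_div_sub_one.tendsto_of_tendsto_comp hζ
    (hbounds.mono fun _ h => h.1) ?_
  simp only [hζslope]
  exact tendsto_of_tendsto_of_tendsto_of_le_of_le' hlower hupper
    (hbounds.mono fun _ h => h.2.1) (hbounds.mono fun _ h => h.2.2)
end

section
/- Fix c > 1 and β > 0, and let ζ* be the unique solution in (0,1) of exp( √(c·β)·( exp(√(c/β)·(x−1)) − 1 ) ) = x. For each n set m(n) = ⌈β·n⌉, and for each n with m(n)·n > c set p_n = √(c/(m(n)·n)) and let ρ_n be the unique solution in [0,1) of the equation x = [1 − p_n·(1 − (1 − p_n·(1−x))^n)]^{m(n)}. Then ρ_n → ζ* as n → ∞. -/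
open Filter

/-- If `u → 0` and `k * u → t` then `(1 + u) ^ k → exp t`. -/
theorem tendsto_one_add_pow_exp {u : ℕ → ℝ} {k : ℕ → ℕ} {t : ℝ}
    (hu : Tendsto u atTop (nhds 0)) (hk : Tendsto (fun n => (k n : ℝ) * u n) atTop (nhds t)) :
    Tendsto (fun n => (1 + u n) ^ k n) atTop (nhds (Real.exp t)) := by
  have hd : HasDerivAt (fun x : ℝ => Real.log (1 + x)) 1 0 := by
    simpa using ((hasDerivAt_id (0 : ℝ)).const_add 1).log (by norm_num)
  have hcont : ContinuousAt (dslope (fun x : ℝ => Real.log (1 + x)) 0) 0 :=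
    continuousAt_dslope_same.2 hd.differentiableAt
  have hds : Tendsto (fun n => dslope (fun x : ℝ => Real.log (1 + x)) 0 (u n)) atTop
      (nhds 1) := by
    have := hcont.tendsto.comp hu
    rwa [dslope_same, hd.deriv] at this
  have hlog := (hk.mul hds).rexp
  rw [mul_one] at hlog
  refine hlog.congr' ?_
  filter_upwards [hu.eventually (lt_mem_nhds (show (-1 : ℝ) < 0 by norm_num))] with n hn
  have h := sub_smul_dslope (fun x : ℝ => Real.log (1 + x)) 0 (u n)
  simp only [sub_zero, smul_eq_mul, add_zero, Real.log_one] at h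
  rw [mul_assoc, h, Real.exp_nat_mul, Real.exp_log (by linarith)]

/-- The offspring generating function over two generations is convex on `[0, 1]`. -/
theorem convexOn_binomial_comp {p : ℝ} (hp0 : 0 ≤ p) (hp1 : p ≤ 1) (n m : ℕ) :
    ConvexOn ℝ (Set.Icc (0 : ℝ) 1)
      (fun x => (1 - p * (1 - (1 - p * (1 - x)) ^ n)) ^ m) := by
  have haff : ConvexOn ℝ (Set.Icc (0 : ℝ) 1) (fun x => 1 - p * (1 - x)) := by
    refine ⟨convex_Icc 0 1, fun x _ y _ s t _ _ hst => le_of_eq ?_⟩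
    simp only [smul_eq_mul]
    linear_combination (p - 1) * hst
  have hnn : ∀ ⦃x : ℝ⦄, x ∈ Set.Icc (0 : ℝ) 1 → 0 ≤ 1 - p * (1 - x) := by
    rintro x ⟨h0, h1⟩
    nlinarith
  have hin := haff.pow hnn n
  refine ConvexOn.pow ?_ ?_ m
  · refine ⟨convex_Icc 0 1, fun x hx y hy s t hs ht hst => ?_⟩
    have h := mul_le_mul_of_nonneg_left (hin.2 hx hy hs ht hst) hp0
    simp only [smul_eq_mul, Pi.pow_apply] at h ⊢
    linear_combination h + (p - 1) * hst
  · intro x hx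
    have := pow_nonneg (hnn hx) n
    nlinarith

/-- A convex function on `[0, 1]` fixing `r < 1` and `1` lies above the diagonal on `[0, r)`. -/
theorem ConvexOn.le_apply_of_lt_fixed {f : ℝ → ℝ} (hf : ConvexOn ℝ (Set.Icc (0 : ℝ) 1) f)
    {r x : ℝ} (hr : r < 1) (hfr : f r = r) (hf1 : f 1 = 1) (hx : 0 ≤ x) (hxr : x < r) :
    x ≤ f x := by
  have h := hf.slope_mono_adjacent (x := x) (y := r) (z := 1) ⟨hx, by linarith⟩
    ⟨by linarith, le_rfl⟩ hxr hr
  rw [hfr, hf1, div_self (by linarith), div_le_one (by linarith)] at h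
  linarith

/-- A convex function on `[0, 1]` fixing `r` and `1` lies below the diagonal on `(r, 1)`. -/
theorem ConvexOn.apply_le_of_fixed_lt {f : ℝ → ℝ} (hf : ConvexOn ℝ (Set.Icc (0 : ℝ) 1) f)
    {r x : ℝ} (hr : 0 ≤ r) (hfr : f r = r) (hf1 : f 1 = 1) (hrx : r < x) (hx : x < 1) :
    f x ≤ x := by
  have h := hf.slope_mono_adjacent (x := r) (y := x) (z := 1) ⟨hr, by linarith⟩
    ⟨by linarith, le_rfl⟩ hrx hx
  rw [hfr, hf1, div_le_div_iff₀ (by linarith) (by linarith)] at h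
  nlinarith

/-- The compound Poisson generating function is strictly convex. -/
theorem strictConvexOn_exp_mul_exp {a b : ℝ} (ha : 0 < a) (hb : 0 < b) :
    StrictConvexOn ℝ Set.univ
      (fun x => Real.exp (a * (Real.exp (b * (x - 1)) - 1))) := by
  refine ⟨convex_univ, fun x _ y _ hxy s t hs ht hst => ?_⟩
  have hne : a * (Real.exp (b * (x - 1)) - 1) ≠ a * (Real.exp (b * (y - 1)) - 1) := by
    intro h
    have h1 := Real.exp_injective (sub_left_injective (mul_left_cancel₀ ha.ne' h))
    exact hxy (sub_left_injective (mul_left_cancel₀ hb.ne' h1))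
  have h1 := strictConvexOn_exp.2 (Set.mem_univ _) (Set.mem_univ _) hne hs ht hst
  refine lt_of_le_of_lt (Real.exp_le_exp.2 ?_) h1
  have h2 := convexOn_exp.2 (Set.mem_univ (b * (x - 1))) (Set.mem_univ (b * (y - 1)))
    hs.le ht.le hst
  have h3 : b * (s * x + t * y - 1) = s * (b * (x - 1)) + t * (b * (y - 1)) := by
    linear_combination b * hst
  simp only [smul_eq_mul] at h2 ⊢
  rw [h3]
  linear_combination a * h2 + a * hst

/-- Scaling of the attribute probability: `n * p_n → √(c / β)`. -/
theorem tendsto_mul_attribute_prob {c β : ℝ} (hβ : 0 < β) :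
    Tendsto (fun n : ℕ => (n : ℝ) * Real.sqrt (c / (⌈β * n⌉₊ * n))) atTop
      (nhds (Real.sqrt (c / β))) := by
  have hm : Tendsto (fun n : ℕ => (⌈β * n⌉₊ : ℝ) / n) atTop (nhds β) :=
    (tendsto_nat_ceil_mul_div_atTop hβ.le).comp tendsto_natCast_atTop_atTop
  refine ((tendsto_const_nhds (x := c)).div hm hβ.ne').sqrt.congr' ?_
  filter_upwards [eventually_gt_atTop 0] with n hn
  have hn' : (0 : ℝ) < n := by exact_mod_cast hn
  have hm' : (⌈β * n⌉₊ : ℝ) ≠ 0 := by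
    have : 0 < ⌈β * n⌉₊ := Nat.ceil_pos.2 (mul_pos hβ hn')
    exact_mod_cast this.ne'
  have hsqrt := Real.sqrt_mul (sq_nonneg (n : ℝ)) (c / (⌈β * n⌉₊ * n))
  rw [Real.sqrt_sq hn'.le] at hsqrt
  rw [← hsqrt]
  congr 1
  simp only [Pi.div_apply]
  field_simp

/-- Pointwise convergence of the offspring generating functions. -/
theorem tendsto_binomial_comp {c β : ℝ} (hβ : 0 < β) (x : ℝ) :
    Tendsto (fun n : ℕ => (1 - Real.sqrt (c / (⌈β * n⌉₊ * n)) *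
        (1 - (1 - Real.sqrt (c / (⌈β * n⌉₊ * n)) * (1 - x)) ^ n)) ^ ⌈β * n⌉₊) atTop
      (nhds (Real.exp (Real.sqrt (c * β) *
        (Real.exp (Real.sqrt (c / β) * (x - 1)) - 1)))) := by
  have hnp := tendsto_mul_attribute_prob (c := c) hβ
  have hm : Tendsto (fun n : ℕ => (⌈β * n⌉₊ : ℝ) / n) atTop (nhds β) :=
    (tendsto_nat_ceil_mul_div_atTop hβ.le).comp tendsto_natCast_atTop_atTop
  set p : ℕ → ℝ := fun n => Real.sqrt (c / (⌈β * n⌉₊ * n))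
  have hp0 : Tendsto p atTop (nhds 0) := by
    have h := hnp.mul (tendsto_inv_atTop_nhds_zero_nat (𝕜 := ℝ))
    rw [mul_zero] at h
    refine h.congr' ?_
    filter_upwards [eventually_gt_atTop 0] with n hn
    have hn' : (n : ℝ) ≠ 0 := by exact_mod_cast hn.ne'
    rw [mul_comm, inv_mul_cancel_left₀ hn']
  have hmp : Tendsto (fun n : ℕ => (⌈β * n⌉₊ : ℝ) * p n) atTop
      (nhds (Real.sqrt (c * β))) := by
    have h := hm.mul hnp
    have hval : β * Real.sqrt (c / β) = Real.sqrt (c * β) := by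
      nth_rewrite 1 [← Real.sqrt_sq hβ.le]
      rw [← Real.sqrt_mul (sq_nonneg _)]
      congr 1
      field_simp
    rw [hval] at h
    refine h.congr' ?_
    filter_upwards [eventually_gt_atTop 0] with n hn
    have hn' : (n : ℝ) ≠ 0 := by exact_mod_cast hn.ne'
    rw [div_mul_eq_mul_div, mul_div_assoc, mul_div_cancel_left₀ _ hn']
  have hin : Tendsto (fun n => (1 + p n * (x - 1)) ^ n) atTop
      (nhds (Real.exp (Real.sqrt (c / β) * (x - 1)))) := by
    refine tendsto_one_add_pow_exp (k := fun n => n) ?_ ?_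
    · simpa using hp0.mul_const (x - 1)
    · simpa only [mul_assoc] using hnp.mul_const (x - 1)
  have hout := tendsto_one_add_pow_exp (k := fun n => ⌈β * n⌉₊)
    (u := fun n => p n * ((1 + p n * (x - 1)) ^ n - 1))
    (by simpa using hp0.mul (hin.sub_const 1))
    (by simpa only [mul_assoc] using hmp.mul (hin.sub_const 1))
  refine hout.congr fun n => ?_
  have h1 : 1 - p n * (1 - x) = 1 + p n * (x - 1) := by ring
  change _ = (1 - p n * (1 - (1 - p n * (1 - x)) ^ n)) ^ ⌈β * n⌉₊
  rw [h1]
  congr 1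
  ring

/-- homogeneous case, `m = Θ(n)`: fix `c > 1` and `β > 0`, and let
`ζ*` be the solution in `(0,1)` of `exp(√(cβ)·(exp(√(c/β)·(x-1)) - 1)) = x`. With
`m(n) = ⌈β·n⌉`, `p_n = √(c/(m(n)·n))`, if `ρ_n ∈ [0,1)` solves
`x = (1 - p_n·(1 - (1 - p_n·(1-x))^n))^{m(n)}` for every `n` with `m(n)·n > c`, then
`ρ_n → ζ*`. -/
theorem extinction_asymptotics_m_linear (c β : ℝ) (hc : 1 < c) (hβ : 0 < β)
    (ζ : ℝ) (hζ : ζ ∈ Set.Ioo (0 : ℝ) 1)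
    (hζeq : Real.exp (Real.sqrt (c * β) *
      (Real.exp (Real.sqrt (c / β) * (ζ - 1)) - 1)) = ζ)
    (ρ : ℕ → ℝ)
    (hρ : ∀ n : ℕ, c < ((⌈β * n⌉₊ : ℝ)) * n →
      ρ n ∈ Set.Ico (0 : ℝ) 1 ∧
      ρ n = (1 - Real.sqrt (c / (⌈β * n⌉₊ * n)) *
        (1 - (1 - Real.sqrt (c / (⌈β * n⌉₊ * n)) * (1 - ρ n)) ^ n)) ^ ⌈β * n⌉₊) :
    Tendsto ρ atTop (nhds ζ) := by
  have ha : 0 < Real.sqrt (c * β) := Real.sqrt_pos.2 (by positivity)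
  have hb : 0 < Real.sqrt (c / β) := Real.sqrt_pos.2 (by positivity)
  have hconv := strictConvexOn_exp_mul_exp ha hb
  have hlim := fun x => tendsto_binomial_comp (c := c) hβ x
  set F : ℝ → ℝ := fun x => Real.exp (Real.sqrt (c * β) *
      (Real.exp (Real.sqrt (c / β) * (x - 1)) - 1)) with hF
  have hF1 : F 1 = 1 := by simp [hF]
  have hFζ : F ζ = ζ := hζeq
  obtain ⟨hζ0, hζ1⟩ := hζ
  have hsuper : ∀ᶠ n : ℕ in atTop, c < (⌈β * n⌉₊ : ℝ) * n := by
    have h : Tendsto (fun n : ℕ => β * n * n) atTop atTop :=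
      (tendsto_natCast_atTop_atTop.const_mul_atTop hβ).atTop_mul_atTop₀
        tendsto_natCast_atTop_atTop
    filter_upwards [h.eventually_gt_atTop c] with n hn
    exact hn.trans_le (mul_le_mul_of_nonneg_right (Nat.le_ceil _) n.cast_nonneg)
  have hconvn : ∀ n : ℕ, c < (⌈β * n⌉₊ : ℝ) * n → ConvexOn ℝ (Set.Icc (0 : ℝ) 1)
      (fun x => (1 - Real.sqrt (c / (⌈β * n⌉₊ * n)) *
        (1 - (1 - Real.sqrt (c / (⌈β * n⌉₊ * n)) * (1 - x)) ^ n)) ^ ⌈β * n⌉₊) := by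
    intro n hn
    refine convexOn_binomial_comp (Real.sqrt_nonneg _) ?_ _ _
    refine Real.sqrt_le_one.2 ?_
    exact div_le_one_of_le₀ hn.le (by positivity)
  refine tendsto_order.2 ⟨fun y hy => ?_, fun y hy => ?_⟩
  · obtain ⟨x, hx, hxζ⟩ := exists_between (max_lt hy hζ0)
    obtain ⟨hyx, hx0⟩ := max_lt_iff.1 hx
    have hFx : x < F x := by
      have h := hconv.slope_strict_mono_adjacent (Set.mem_univ x) (Set.mem_univ 1) hxζ hζ1
      change (F ζ - F x) / (ζ - x) < (F 1 - F ζ) / (1 - ζ) at h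
      rw [hFζ, hF1, div_self (by linarith), div_lt_one (by linarith)] at h
      linarith
    filter_upwards [hsuper, (hlim x).eventually (lt_mem_nhds hFx)] with n hn hxn
    obtain ⟨⟨h0, h1⟩, heq⟩ := hρ n hn
    by_contra! hle
    exact hxn.not_ge ((hconvn n hn).apply_le_of_fixed_lt h0 heq.symm (by simp)
      (hle.trans_lt hyx) (hxζ.trans hζ1))
  · obtain ⟨x, hζx, hx⟩ := exists_between (lt_min hy hζ1)
    obtain ⟨hxy, hx1⟩ := lt_min_iff.1 hx
    have hFx : F x < x := by
      have h := hconv.slope_strict_mono_adjacent (Set.mem_univ ζ) (Set.mem_univ 1) hζx hx1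
      change (F x - F ζ) / (x - ζ) < (F 1 - F x) / (1 - x) at h
      rw [hFζ, hF1, div_lt_div_iff₀ (by linarith) (by linarith)] at h
      nlinarith
    filter_upwards [hsuper, (hlim x).eventually (gt_mem_nhds hFx)] with n hn hxn
    obtain ⟨⟨h0, h1⟩, heq⟩ := hρ n hn
    by_contra! hle
    exact hxn.not_ge ((hconvn n hn).le_apply_of_lt_fixed h1 heq.symm (by simp)
      (hζ0.trans hζx).le (hxy.trans_le hle))
end
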